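/- Let P be a seminegative non-disjunctive logic program and let N(P) = (P' ∪ P_¬, <) be its ordered version, where P_¬ = {¬a ← | a ∈ H_B(P)}, P' is obtained from P by replacing each naf-literal not p by ¬p, and every rule of P' is <-smaller than every rule of P_¬. Then M is a stable model of P if and only if M ∪ ¬(H_B(P) \ M) is a proper preferred answer set of N(P). -/

import Mathlib

namespace ASP

/-- A literal is an atom `a` or a negated atom `¬ a`. -/
inductive Lit (α : Type) : Type where
  | pos (a : α)
  | neg (a : α)
deriving DecidableEq

/-- Classical negation of a literal. -/
def Lit.negate {α : Type} : Lit α → Lit α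
  | .pos a => .neg a
  | .neg a => .pos a

/-- The atom underlying a literal. -/
def Lit.atom {α : Type} : Lit α → α
  | .pos a => a
  | .neg a => a

/-- A rule of a simple logic program: a head which is a literal or absent
(a constraint), and a finite set of literals as body. -/
structure Rule (α : Type) [DecidableEq α] : Type where
  head : Option (Lit α)
  body : Finset (Lit α)

variable {α : Type} [DecidableEq α]

/-- A set of literals is consistent if it contains no complementary pair. -/
def Consistent (I : Set (Lit α)) : Prop :=
  ∀ a : α, ¬(Lit.pos a ∈ I ∧ Lit.neg a ∈ I)

/-- The Herbrand base of a program: all atoms occurring in it. -/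
def herbrand (P : Set (Rule α)) : Set α :=
  {a | ∃ r ∈ P, (∃ l, r.head = some l ∧ l.atom = a) ∨ (∃ l ∈ r.body, l.atom = a)}

/-- An interpretation of `P`: a consistent set of literals over the Herbrand base of `P`. -/
def IsInterp (P : Set (Rule α)) (I : Set (Lit α)) : Prop :=
  Consistent I ∧ ∀ l ∈ I, l.atom ∈ herbrand P

/-- A rule `a ← β` is satisfied by `I` if `a ∈ I` whenever `β ⊆ I`;
a constraint `← β` is satisfied if its body is not contained in `I`. -/
def Satisfied (I : Set (Lit α)) (r : Rule α) : Prop :=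
  ↑r.body ⊆ I → ∃ l, r.head = some l ∧ l ∈ I

/-- A rule is applied w.r.t. `I` if its body holds and its head literal is in `I`. -/
def Applied (I : Set (Lit α)) (r : Rule α) : Prop :=
  ↑r.body ⊆ I ∧ ∃ l, r.head = some l ∧ l ∈ I

/-- A rule `a ← β` is defeated w.r.t. `P` and `I` iff `P` contains an applied
competing rule `¬a ← β'`. -/
def Defeated (P : Set (Rule α)) (I : Set (Lit α)) (r : Rule α) : Prop :=
  ∃ l, r.head = some l ∧ ∃ r' ∈ P, r'.head = some l.negate ∧ Applied I r'

/-- The reduct of `P` w.r.t. `I`: the rules of `P` satisfied by `I`. -/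
def reduct (P : Set (Rule α)) (I : Set (Lit α)) : Set (Rule α) :=
  {r ∈ P | Satisfied I r}

/-- `star R` is the unique minimal model of `R` viewed as a positive program
(negative literals treated as fresh atoms; constraints never fire their head). -/
def star (R : Set (Rule α)) : Set (Lit α) :=
  ⋂₀ {J : Set (Lit α) | ∀ r ∈ R, ↑r.body ⊆ J → ∀ l, r.head = some l → l ∈ J}

/-- An interpretation is founded iff `(P_I)* = I`. -/
def Founded (P : Set (Rule α)) (I : Set (Lit α)) : Prop :=
  star (reduct P I) = I

/-- A founded interpretation `M` is an extended answer set of `P` iff every rule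
of `P` is satisfied or defeated w.r.t. `M`. -/
def ExtAnswerSet (P : Set (Rule α)) (M : Set (Lit α)) : Prop :=
  IsInterp P M ∧ Founded P M ∧ ∀ r ∈ P, Satisfied M r ∨ Defeated P M r

/-- An answer set of a program without negation as failure: a minimal
interpretation satisfying all rules of the program. -/
def IsAnswerSet (P : Set (Rule α)) (M : Set (Lit α)) : Prop :=
  IsInterp P M ∧ (∀ r ∈ P, Satisfied M r) ∧
    ∀ J, IsInterp P J → (∀ r ∈ P, Satisfied J r) → ¬J ⊂ M


section OLP

variable {α : Type} [DecidableEq α]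

/-- `R₁ ⊑ R₂` for sets of rules: every rule in `R₂ \ R₁` is countered by a
`<`-smaller rule in `R₁ \ R₂`. -/
def RuleSq (lt : Rule α → Rule α → Prop) (R₁ R₂ : Set (Rule α)) : Prop :=
  ∀ r₂ ∈ R₂ \ R₁, ∃ r₁ ∈ R₁ \ R₂, lt r₁ r₂

/-- `M₁ ⊑ M₂` for (extended) answer sets of an ordered program: the induced
order on their reducts. -/
def ASSq (P : Set (Rule α)) (lt : Rule α → Rule α → Prop)
    (M₁ M₂ : Set (Lit α)) : Prop :=
  RuleSq lt (reduct P M₁) (reduct P M₂)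

/-- `M₁ ⊏ M₂` iff `M₁ ⊑ M₂` and not `M₂ ⊑ M₁`. -/
def ASLt (P : Set (Rule α)) (lt : Rule α → Rule α → Prop)
    (M₁ M₂ : Set (Lit α)) : Prop :=
  ASSq P lt M₁ M₂ ∧ ¬ ASSq P lt M₂ M₁

/-- An answer set is proper iff it satisfies all `<`-minimal rules of `P`. -/
def ProperAS (P : Set (Rule α)) (lt : Rule α → Rule α → Prop)
    (M : Set (Lit α)) : Prop :=
  ∀ r ∈ P, (∀ r' ∈ P, ¬ lt r' r) → Satisfied M r

/-- A preferred answer set of the ordered program `(P, lt)`: an extended answer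
set of `P` that is `⊑`-minimal among the extended answer sets of `P`. -/
def PreferredAS (P : Set (Rule α)) (lt : Rule α → Rule α → Prop)
    (M : Set (Lit α)) : Prop :=
  ExtAnswerSet P M ∧ ∀ N, ExtAnswerSet P N → ¬ ASLt P lt N M

end OLP

section Seminegative

variable {α : Type} [DecidableEq α]

/-- A rule of a seminegative (non-disjunctive) logic program: an atom as head,
a finite set of atoms as positive body, and a finite set of atoms occurring
under negation as failure in the body. -/
structure SRule (α : Type) [DecidableEq α] : Type where
  head : α
  bodyPos : Finset α
  bodyNaf : Finset α

/-- The Herbrand base of a seminegative program. -/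
def herbrandS (P : Set (SRule α)) : Set α :=
  {a | ∃ r ∈ P, r.head = a ∨ a ∈ r.bodyPos ∨ a ∈ r.bodyNaf}

/-- The Gelfond–Lifschitz reduct `P^M` of a seminegative program, a positive
atom program given as a set of (head, body) pairs. -/
def SGLreduct (P : Set (SRule α)) (M : Set α) : Set (α × Finset α) :=
  {p | ∃ r ∈ P, (∀ b ∈ r.bodyNaf, b ∉ M) ∧ p = (r.head, r.bodyPos)}

/-- The minimal model of a positive atom program. -/
def leastModelA (R : Set (α × Finset α)) : Set α :=
  ⋂₀ {J : Set α | ∀ p ∈ R, ↑p.2 ⊆ J → p.1 ∈ J}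

/-- `M ⊆ H_B(P)` is a stable model of the seminegative program `P` iff `M`
equals the minimal model of the reduct `P^M`. -/
def StableModel (P : Set (SRule α)) (M : Set α) : Prop :=
  M ⊆ herbrandS P ∧ leastModelA (SGLreduct P M) = M

end Seminegative

section Stmt9

variable {α : Type} [DecidableEq α]

/-- The rules `{¬a ← | a ∈ H_B(P)}` of the ordered version `N(P)`. -/
def PnegOf (P : Set (SRule α)) : Set (Rule α) :=
  {r | ∃ a ∈ herbrandS P, r = ⟨some (Lit.neg a), ∅⟩}

/-- `P'`: the rules of `P` with each naf-literal `not p` replaced by `¬p`. -/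
def PprimeOf (P : Set (SRule α)) : Set (Rule α) :=
  {r | ∃ s ∈ P, r = ⟨some (Lit.pos s.head),
    s.bodyPos.image Lit.pos ∪ s.bodyNaf.image Lit.neg⟩}

/-- The program of the ordered version `N(P) = (P' ∪ P_¬, <)`. -/
def NProg (P : Set (SRule α)) : Set (Rule α) :=
  PprimeOf P ∪ PnegOf P

/-- The order of `N(P)`: every rule of `P'` is more preferred than every rule
of `P_¬`. -/
def Nlt (P : Set (SRule α)) : Rule α → Rule α → Prop :=
  fun r₁ r₂ => r₁ ∈ PprimeOf P ∧ r₂ ∈ PnegOf P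

/-- The literal interpretation `M ∪ ¬(H_B(P) \ M)`. -/
def completion (P : Set (SRule α)) (M : Set α) : Set (Lit α) :=
  Lit.pos '' M ∪ Lit.neg '' (herbrandS P \ M)

@[simp] theorem pos_mem_completion {P : Set (SRule α)} {M : Set α} {a : α} :
    Lit.pos a ∈ completion P M ↔ a ∈ M := by
  simp [completion]

@[simp] theorem neg_mem_completion {P : Set (SRule α)} {M : Set α} {a : α} :
    Lit.neg a ∈ completion P M ↔ a ∈ herbrandS P ∧ a ∉ M := by
  simp [completion]

/-- The rule of `P'` obtained from a seminegative rule. -/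
def SRule.toRule (s : SRule α) : Rule α :=
  ⟨some (Lit.pos s.head), s.bodyPos.image Lit.pos ∪ s.bodyNaf.image Lit.neg⟩

theorem SRule.toRule_mem_NProg {P : Set (SRule α)} {s : SRule α} (hs : s ∈ P) :
    s.toRule ∈ NProg P :=
  Or.inl ⟨s, hs, rfl⟩

theorem neg_fact_mem_NProg {P : Set (SRule α)} {a : α} (ha : a ∈ herbrandS P) :
    (⟨some (Lit.neg a), ∅⟩ : Rule α) ∈ NProg P :=
  Or.inr ⟨a, ha, rfl⟩

theorem SRule.toRule_body_subset {s : SRule α} {I : Set (Lit α)} :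
    (↑s.toRule.body : Set (Lit α)) ⊆ I ↔
      (∀ a ∈ s.bodyPos, Lit.pos a ∈ I) ∧ ∀ a ∈ s.bodyNaf, Lit.neg a ∈ I := by
  simp [SRule.toRule, Set.subset_def, or_imp, forall_and]

theorem SRule.satisfied_toRule {s : SRule α} {I : Set (Lit α)} :
    Satisfied I s.toRule ↔
      ((∀ a ∈ s.bodyPos, Lit.pos a ∈ I) → (∀ a ∈ s.bodyNaf, Lit.neg a ∈ I) →
        Lit.pos s.head ∈ I) := by
  rw [Satisfied, SRule.toRule_body_subset, and_imp]
  simp [SRule.toRule]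

theorem satisfied_neg_fact {a : α} {I : Set (Lit α)} :
    Satisfied I ⟨some (Lit.neg a), ∅⟩ ↔ Lit.neg a ∈ I := by
  simp [Satisfied]

theorem herbrand_NProg (P : Set (SRule α)) : herbrand (NProg P) = herbrandS P := by
  ext a
  constructor
  · rintro ⟨r, ⟨s, hs, rfl⟩ | ⟨b, hb, rfl⟩, h⟩
    · rcases h with ⟨l, hl, rfl⟩ | ⟨l, hl, rfl⟩
      · obtain rfl : Lit.pos s.head = l := Option.some.inj hl
        exact ⟨s, hs, Or.inl rfl⟩
      · simp only [Finset.mem_union, Finset.mem_image] at hl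
        rcases hl with ⟨b, hb, rfl⟩ | ⟨b, hb, rfl⟩
        · exact ⟨s, hs, Or.inr (Or.inl hb)⟩
        · exact ⟨s, hs, Or.inr (Or.inr hb)⟩
    · rcases h with ⟨l, hl, rfl⟩ | ⟨l, hl, rfl⟩
      · obtain rfl : Lit.neg b = l := Option.some.inj hl
        exact hb
      · simp at hl
  · intro ha
    exact ⟨_, neg_fact_mem_NProg ha, Or.inl ⟨Lit.neg a, rfl, rfl⟩⟩

theorem isInterp_completion {P : Set (SRule α)} {M : Set α} (hM : M ⊆ herbrandS P) :
    IsInterp (NProg P) (completion P M) := by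
  refine ⟨fun a h => ?_, fun l hl => ?_⟩
  · simp only [pos_mem_completion, neg_mem_completion] at h
    exact h.2.2 h.1
  · rw [herbrand_NProg]
    cases l with
    | pos a => exact hM (pos_mem_completion.1 hl)
    | neg a => exact (neg_mem_completion.1 hl).1

theorem star_subset {R : Set (Rule α)} {J : Set (Lit α)}
    (hJ : ∀ r ∈ R, ↑r.body ⊆ J → ∀ l, r.head = some l → l ∈ J) : star R ⊆ J :=
  Set.sInter_subset_of_mem hJ

theorem star_mono {R S : Set (Rule α)} (h : R ⊆ S) : star R ⊆ star S :=
  Set.sInter_subset_sInter fun _ hJ r hr => hJ r (h hr)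

theorem star_reduct_subset (P : Set (Rule α)) (I : Set (Lit α)) : star (reduct P I) ⊆ I := by
  refine star_subset fun r hr hb l hl => ?_
  obtain ⟨l', hl', hmem⟩ := hr.2 hb
  obtain rfl : l' = l := Option.some.inj (hl'.symm.trans hl)
  exact hmem

theorem leastModelA_subset {R : Set (α × Finset α)} {J : Set α}
    (hJ : ∀ p ∈ R, ↑p.2 ⊆ J → p.1 ∈ J) : leastModelA R ⊆ J :=
  Set.sInter_subset_of_mem hJ

theorem head_mem_leastModelA {R : Set (α × Finset α)} {p : α × Finset α} (hp : p ∈ R)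
    (hb : ↑p.2 ⊆ leastModelA R) : p.1 ∈ leastModelA R :=
  Set.mem_sInter.2 fun _ hJ => hJ p hp (hb.trans (Set.sInter_subset_of_mem hJ))

/-- Every atom of the minimal model is the head of a rule whose body holds in it. -/
theorem exists_rule_of_mem_leastModelA {R : Set (α × Finset α)} {a : α}
    (ha : a ∈ leastModelA R) : ∃ p ∈ R, p.1 = a ∧ ↑p.2 ⊆ leastModelA R := by
  by_contra! h
  have hsub : leastModelA R ⊆ leastModelA R \ {a} := by
    refine leastModelA_subset fun p hp hb => ?_
    have hb' := hb.trans Set.sdiff_subset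
    exact ⟨head_mem_leastModelA hp hb', fun hpa => h p hp hpa hb'⟩
  exact (hsub ha).2 rfl

/-- A set of atoms is a stable model iff its completion satisfies `P'` and is founded. -/
theorem stableModel_iff_founded_completion {P : Set (SRule α)} {M : Set α}
    (hM : M ⊆ herbrandS P) :
    StableModel P M ↔
      (∀ s ∈ P, Satisfied (completion P M) s.toRule) ∧
        Founded (NProg P) (completion P M) := by
  constructor
  · rintro ⟨-, hst⟩
    have hsat : ∀ s ∈ P, Satisfied (completion P M) s.toRule := by
      intro s hs
      simp only [SRule.satisfied_toRule, pos_mem_completion, neg_mem_completion]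
      intro hpos hnaf
      rw [← hst]
      refine head_mem_leastModelA (p := (s.head, s.bodyPos))
        ⟨s, hs, fun b hb => (hnaf b hb).2, rfl⟩ ?_
      rw [hst]
      exact hpos
    refine ⟨hsat, (star_reduct_subset _ _).antisymm fun l hl => Set.mem_sInter.2 fun J hJ => ?_⟩
    have hneg : ∀ a ∈ herbrandS P, a ∉ M → Lit.neg a ∈ J := fun a ha haM =>
      hJ _ ⟨neg_fact_mem_NProg ha, satisfied_neg_fact.2 (neg_mem_completion.2 ⟨ha, haM⟩)⟩
        (by simp) _ rfl
    cases l with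
    | neg a =>
      obtain ⟨ha, haM⟩ := neg_mem_completion.1 hl
      exact hneg a ha haM
    | pos a =>
      have hsub : leastModelA (SGLreduct P M) ⊆ {b | Lit.pos b ∈ J} := by
        refine leastModelA_subset ?_
        rintro _ ⟨s, hs, hnaf, rfl⟩ hb
        exact hJ _ ⟨SRule.toRule_mem_NProg hs, hsat s hs⟩
          (SRule.toRule_body_subset.2 ⟨fun b hb' => hb hb',
            fun b hb' => hneg b ⟨s, hs, Or.inr (Or.inr hb')⟩ (hnaf b hb')⟩) _ rfl
      rw [hst] at hsub
      exact hsub (pos_mem_completion.1 hl)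
  · rintro ⟨hsat, hf⟩
    refine ⟨hM, (leastModelA_subset ?_).antisymm fun a ha => Set.mem_sInter.2 fun J hJ => ?_⟩
    · rintro _ ⟨s, hs, hnaf, rfl⟩ hb
      exact pos_mem_completion.1 (SRule.satisfied_toRule.1 (hsat s hs)
        (fun b hb' => pos_mem_completion.2 (hb hb'))
        fun b hb' => neg_mem_completion.2 ⟨⟨s, hs, Or.inr (Or.inr hb')⟩, hnaf b hb'⟩)
    · have hsub : star (reduct (NProg P) (completion P M)) ⊆
          Lit.pos '' J ∪ Lit.neg '' (herbrandS P \ M) := by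
        refine star_subset ?_
        rintro _ ⟨⟨s, hs, rfl⟩ | ⟨b, hb, rfl⟩, hr⟩ hbody l hl
        · obtain rfl : Lit.pos s.head = l := Option.some.inj hl
          obtain ⟨hpos, hnaf⟩ := SRule.toRule_body_subset.1 hbody
          refine Or.inl ⟨_, hJ (s.head, s.bodyPos) ⟨s, hs, fun b hb => ?_, rfl⟩
            fun b hb => ?_, rfl⟩
          · have := hnaf b hb
            simp at this
            exact this.2
          · simpa using hpos b hb
        · obtain rfl : Lit.neg b = l := Option.some.inj hl
          exact Or.inr ⟨b, neg_mem_completion.1 (satisfied_neg_fact.1 hr), rfl⟩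
      rw [hf] at hsub
      simpa using hsub (pos_mem_completion.2 ha)

theorem StableModel.extAnswerSet_completion {P : Set (SRule α)} {M : Set α}
    (h : StableModel P M) : ExtAnswerSet (NProg P) (completion P M) := by
  obtain ⟨hsat, hf⟩ := (stableModel_iff_founded_completion h.1).1 h
  refine ⟨isInterp_completion h.1, hf, ?_⟩
  rintro _ (⟨s, hs, rfl⟩ | ⟨a, ha, rfl⟩)
  · exact Or.inl (hsat s hs)
  · by_cases haM : a ∈ M
    · right
      have ha' := haM
      rw [← h.2] at ha'
      obtain ⟨_, ⟨s, hs, hnaf, rfl⟩, rfl, hb⟩ := exists_rule_of_mem_leastModelA ha'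
      rw [h.2] at hb
      exact ⟨_, rfl, s.toRule, SRule.toRule_mem_NProg hs, rfl,
        SRule.toRule_body_subset.2 ⟨fun b hb' => pos_mem_completion.2 (hb hb'),
          fun b hb' => neg_mem_completion.2 ⟨⟨s, hs, Or.inr (Or.inr hb')⟩, hnaf b hb'⟩⟩,
        _, rfl, pos_mem_completion.2 haM⟩
    · exact Or.inl (satisfied_neg_fact.2 (neg_mem_completion.2 ⟨ha, haM⟩))

theorem subset_herbrandS_of_isInterp {P : Set (SRule α)} {M : Set α}
    (h : IsInterp (NProg P) (completion P M)) : M ⊆ herbrandS P := fun a ha => by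
  have := h.2 _ (pos_mem_completion.2 ha)
  rwa [herbrand_NProg] at this

theorem not_Nlt_toRule (P : Set (SRule α)) (r : Rule α) (s : SRule α) : ¬ Nlt P r s.toRule := by
  rintro ⟨-, a, -, h⟩
  simp [SRule.toRule] at h

theorem StableModel.preferredAS_completion {P : Set (SRule α)} {M : Set α}
    (h : StableModel P M) : PreferredAS (NProg P) (Nlt P) (completion P M) := by
  have hext := h.extAnswerSet_completion
  obtain ⟨hsat, hf⟩ := (stableModel_iff_founded_completion h.1).1 h
  refine ⟨hext, fun N hN ⟨hle, hnle⟩ => hnle ?_⟩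
  have hred : reduct (NProg P) (completion P M) ⊆ reduct (NProg P) N := by
    intro r hr
    by_contra hrN
    obtain ⟨r₁, ⟨hr₁, hr₁'⟩, ⟨s, hs, rfl⟩, -⟩ := hle r ⟨hr, hrN⟩
    exact hr₁' ⟨hr₁.1, hsat s hs⟩
  have hsub : completion P M ⊆ N := by
    have := star_mono hred
    rwa [hf, hN.2.1] at this
  rintro r ⟨⟨hr, hrN⟩, hrM⟩
  refine absurd ⟨hr, ?_⟩ hrM
  rcases hr with ⟨s, hs, rfl⟩ | ⟨a, ha, rfl⟩
  · exact hsat s hs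
  · refine satisfied_neg_fact.2 (neg_mem_completion.2 ⟨ha, fun haM => ?_⟩)
    exact hN.1.1 a ⟨hsub (pos_mem_completion.2 haM), satisfied_neg_fact.1 hrN⟩

/-- `M` is a stable model of the seminegative program `P` iff
`M ∪ ¬(H_B(P) \ M)` is a proper preferred answer set of `N(P)`. -/
theorem stableModel_iff_proper_preferred_NProg
    (P : Set (SRule α)) (hP : P.Countable) (M : Set α) :
    StableModel P M ↔
      (PreferredAS (NProg P) (Nlt P)
          (Lit.pos '' M ∪ Lit.neg '' (herbrandS P \ M)) ∧
        ProperAS (NProg P) (Nlt P)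
          (Lit.pos '' M ∪ Lit.neg '' (herbrandS P \ M))) := by
  change StableModel P M ↔ PreferredAS (NProg P) (Nlt P) (completion P M) ∧
    ProperAS (NProg P) (Nlt P) (completion P M)
  constructor
  · intro h
    refine ⟨h.preferredAS_completion, ?_⟩
    rintro _ (⟨s, hs, rfl⟩ | ⟨a, ⟨s, hs, ha⟩, rfl⟩) hmin
    · exact ((stableModel_iff_founded_completion h.1).1 h).1 s hs
    · exact absurd ⟨⟨s, hs, rfl⟩, ⟨a, ⟨s, hs, ha⟩, rfl⟩⟩
        (hmin s.toRule (SRule.toRule_mem_NProg hs))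
  · rintro ⟨⟨⟨hint, hf, -⟩, -⟩, hprop⟩
    exact (stableModel_iff_founded_completion (subset_herbrandS_of_isInterp hint)).2
      ⟨fun s hs => hprop _ (SRule.toRule_mem_NProg hs) fun r _ => not_Nlt_toRule P r s, hf⟩

end Stmt9

end ASP
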